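/- Assume k > 2. In the generic band situation, φ̃_1² does not divide a_{k+1,1} · φ̃_2^k + Σ_{i=1}^{k} c̃_i · (a_{k+1,2}⋯a_{k+1,n})^{i−1} · φ̃_{n+1}^i · φ̃_2^{k−i} in R; equivalently, the polynomial φ̃_1* determined by the relation φ̃_1 · φ̃_1* = a_{k+1,1} · φ̃_2^k + Σ_{i=1}^{k} c̃_i · (a_{k+1,2}⋯a_{k+1,n})^{i−1} · φ̃_{n+1}^i · φ̃_2^{k−i} is not divisible by φ̃_1. -/

import Mathlib

open Matrix Finset

noncomputable section

/-- The determinant of the minor of the `ℕ`-indexed (0-based) matrix `Φ` on the 1-based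
row/column range `[i, M]`; for `i = M + 1` this is the determinant of the empty matrix, `1`. -/
def sminor {α : Type*} [CommRing α] (Φ : ℕ → ℕ → α) (i M : ℕ) : α :=
  (Matrix.of fun r c : Fin (M + 1 - i) => Φ (i - 1 + (r : ℕ)) (i - 1 + (c : ℕ))).det

/-- Package an `ℕ`-indexed (0-based) family of entries as an `n × n` matrix. -/
def toSq {α : Type*} (n : ℕ) (f : ℕ → ℕ → α) : Matrix (Fin n) (Fin n) α :=
  Matrix.of fun i j => f (i : ℕ) (j : ℕ)

/-- The core `Φ` of a staircase pair `(X, Y)` of `n × n` matrices with parameters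
`a = k + b`; it is an `N × N` matrix, `N = (k-1)*n + b`, given here as a (0-based)
`ℕ`-indexed family of entries.  For `1 ≤ j ≤ k-1` (1-based), the block rows
`(j-1)(n-1)+1 .. j(n-1)` carry `Y_{[2,n]}` in columns `(j-1)n+1 .. jn` and (for `j ≥ 2`)
`X_{[2,n]}` in columns `(j-2)n+1 .. (j-1)n`; the last `a - 1` rows carry `X_{[2,a]}` in
columns `(k-2)n+1 .. (k-1)n` and `Y_{[2,a]}^{[1,b]}` in columns `(k-1)n+1 .. N`. -/
def stairCore {α : Type*} [Zero α] (n k : ℕ) (Xf Yf : ℕ → ℕ → α) : ℕ → ℕ → α := fun r c =>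
  if r < (k - 1) * (n - 1) then
    if r / (n - 1) * n ≤ c ∧ c < r / (n - 1) * n + n then
      Yf (r % (n - 1) + 1) (c - r / (n - 1) * n)
    else if 1 ≤ r / (n - 1) ∧ (r / (n - 1) - 1) * n ≤ c ∧ c < r / (n - 1) * n then
      Xf (r % (n - 1) + 1) (c - (r / (n - 1) - 1) * n)
    else 0
  else
    if (k - 2) * n ≤ c ∧ c < (k - 1) * n then
      Xf (r - (k - 1) * (n - 1) + 1) (c - (k - 2) * n)
    else if (k - 1) * n ≤ c then
      Yf (r - (k - 1) * (n - 1) + 1) (c - (k - 1) * n)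
    else 0

/-- `det Ȳ`: determinant of the submatrix of `Y` on rows and columns `2..n` (1-based). -/
def detYbar {α : Type*} [CommRing α] (n : ℕ) (Yf : ℕ → ℕ → α) : α :=
  (Matrix.of fun i j : Fin (n - 1) => Yf ((i : ℕ) + 1) ((j : ℕ) + 1)).det

/-- Determinant of the minor of `Y` on rows `{1, 3, 4, …, n}` and columns `{2, …, n}`
(1-based). -/
def detYgamma {α : Type*} [CommRing α] (n : ℕ) (Yf : ℕ → ℕ → α) : α :=
  (Matrix.of fun i j : Fin (n - 1) =>
    Yf (if (i : ℕ) = 0 then 0 else (i : ℕ) + 1) ((j : ℕ) + 1)).det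

/-- `det (λ Y + μ X)` as a polynomial in the two variables `λ = X 0`, `μ = X 1`. -/
def detLM {α : Type*} [CommRing α] (n : ℕ) (Xf Yf : ℕ → ℕ → α) :
    MvPolynomial (Fin 2) α :=
  Matrix.det
    (((MvPolynomial.X 0 : MvPolynomial (Fin 2) α) • (toSq n Yf).map (fun p => MvPolynomial.C p)
      + (MvPolynomial.X 1 : MvPolynomial (Fin 2) α) • (toSq n Xf).map (fun p => MvPolynomial.C p)
      : Matrix (Fin n) (Fin n) (MvPolynomial (Fin 2) α)))

/-- The block `Y2`: submatrix of `Y` on rows `k+1 .. k+b` and columns `1 .. b` (1-based). -/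
def blockY2 (n k b : ℕ) (h : k + b ≤ n) (Y : Matrix (Fin n) (Fin n) ℂ) :
    Matrix (Fin b) (Fin b) ℂ :=
  Matrix.of fun i j => Y ⟨k + (i : ℕ), by have := i.isLt; omega⟩ (Fin.castLE (by omega) j)

/-- The `k × k` matrix `U = W11 - Y1 Y2⁻¹ W21` attached to a staircase pair `(X, Y)`,
where `[[W11, W12], [W21, W22]]` is the `a × a` leading block of `X Y⁻¹` (`W11` of size
`k × k`) and `[Y1; Y2]` is the submatrix of `Y` on rows `1..a`, columns `1..b`. -/
def blockU (n k b : ℕ) (h : k + b ≤ n) (X Y : Matrix (Fin n) (Fin n) ℂ) :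
    Matrix (Fin k) (Fin k) ℂ :=
  (Matrix.of fun i j : Fin k =>
      (X * Y⁻¹) (Fin.castLE (by omega) i) (Fin.castLE (by omega) j))
    - (Matrix.of fun (i : Fin k) (j : Fin b) =>
          Y (Fin.castLE (by omega) i) (Fin.castLE (by omega) j))
      * (blockY2 n k b h Y)⁻¹
      * (Matrix.of fun (i : Fin b) (j : Fin k) =>
          (X * Y⁻¹) ⟨k + (i : ℕ), by have := i.isLt; omega⟩ (Fin.castLE (by omega) j))

/-- The standard basis vector `e_{m+1}` (so `basisVec k 0 = e_1`, `basisVec k 1 = e_2`). -/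
def basisVec (k m : ℕ) : Fin k → ℂ := fun i => if (i : ℕ) = m then 1 else 0

/-- The vector `v_γ = U (e_2 + γ e_1)`, with `γ` the ratio of the minor of `Y` on rows
`{1,3,…,n}`, columns `{2,…,n}` by `det Ȳ`. -/
def vGamma (n k b : ℕ) (h : k + b ≤ n) (X Y : ℕ → ℕ → ℂ) : Fin k → ℂ :=
  (blockU n k b h (toSq n X) (toSq n Y)).mulVec
    (basisVec k 1 + (detYgamma n Y / detYbar n Y) • basisVec k 0)

/-- The coefficient ring for the generic staircase pair: polynomials over `ℂ` in the
variables `x_{ij}` (tagged `true`) and `y_{ij}` (tagged `false`). -/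
abbrev Rgen : Type := MvPolynomial (Bool × ℕ × ℕ) ℂ

/-- The generic staircase matrix `X` (0-based): `x_{ij}` for `i < a`, `b ≤ j < n`, else `0`. -/
def genX (n a b : ℕ) : ℕ → ℕ → Rgen := fun i j =>
  if i < a ∧ b ≤ j ∧ j < n then MvPolynomial.X (true, i, j) else 0

/-- The generic staircase matrix `Y` (0-based): `y_{ij}` except in the zero block
(`i ≥ a`, `j < b`). -/
def genY (n a b : ℕ) : ℕ → ℕ → Rgen := fun i j =>
  if i < n ∧ j < n ∧ ¬(a ≤ i ∧ j < b) then MvPolynomial.X (false, i, j) else 0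

/-- The coefficient ring for the generic band pair: polynomials over `ℂ` in variables
`a_{ij}`. -/
abbrev Rband : Type := MvPolynomial (ℕ × ℕ) ℂ

/-- The generic band entries `a_{ij}` (1-based). -/
def genA : ℕ → ℕ → Rband := fun i j => MvPolynomial.X (i, j)

/-- The band matrix `X` (0-based indices) built from the entries `a_{ij}` (1-based):
`X_{i, n-k+i-1+s} = a_{s,i}` for `1 ≤ i ≤ k`, `1 ≤ s ≤ k+1-i` (1-based). -/
def bandX {α : Type*} [Zero α] (n k : ℕ) (a : ℕ → ℕ → α) : ℕ → ℕ → α := fun i j =>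
  if i < k ∧ n - k + i ≤ j ∧ j < n then a (j + k + 1 - n - i) (i + 1) else 0

/-- The band matrix `Y` (0-based indices) built from the entries `a_{ij}` (1-based):
`Y_{ij} = a_{k+1-i+j, i}` for `max(1, i-k) ≤ j ≤ i` (1-based), `0` otherwise. -/
def bandY {α : Type*} [Zero α] (n k : ℕ) (a : ℕ → ℕ → α) : ℕ → ℕ → α := fun i j =>
  if j ≤ i ∧ i ≤ j + k ∧ i < n then a (k + 1 + j - i) (i + 1) else 0

/-- Top-left `k × k` block of `X * Y⁻¹`. -/
def bandUblock (n k : ℕ) (h : k ≤ n) (Xm Ym : Matrix (Fin n) (Fin n) ℂ) :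
    Matrix (Fin k) (Fin k) ℂ :=
  Matrix.of fun i j => (Xm * Ym⁻¹) (Fin.castLE h i) (Fin.castLE h j)

/-- `K(A;u) = [u, Au, …, A^{k-1}u]`. -/
def Kmat (k : ℕ) (A : Matrix (Fin k) (Fin k) ℂ) (u : Fin k → ℂ) :
    Matrix (Fin k) (Fin k) ℂ :=
  Matrix.of fun i j => (A ^ (j : ℕ)).mulVec u i

/-- `K1(A;u,v) = [v, u, Au, …, A^{k-2}u]`. -/
def K1mat (k : ℕ) (A : Matrix (Fin k) (Fin k) ℂ) (u v : Fin k → ℂ) :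
    Matrix (Fin k) (Fin k) ℂ :=
  Matrix.of fun i j => if (j : ℕ) = 0 then v i else (A ^ ((j : ℕ) - 1)).mulVec u i

/-- `K2(A;u,v) = [Av, u, Au, …, A^{k-2}u]`. -/
def K2mat (k : ℕ) (A : Matrix (Fin k) (Fin k) ℂ) (u v : Fin k → ℂ) :
    Matrix (Fin k) (Fin k) ℂ :=
  Matrix.of fun i j => if (j : ℕ) = 0 then A.mulVec v i else (A ^ ((j : ℕ) - 1)).mulVec u i

/-- `w`: the last row of the classical adjoint of `K1(A;u,v)`. -/
def wRow (k : ℕ) (A : Matrix (Fin k) (Fin k) ℂ) (u v : Fin k → ℂ) : Fin k → ℂ :=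
  fun j => (K1mat k A u v).adjugate ⟨k - 1, by have := j.isLt; omega⟩ j

/-- `K*(A;u,v)`: the matrix with rows `w, wA, …, wA^{k-1}`. -/
def Kstar (k : ℕ) (A : Matrix (Fin k) (Fin k) ℂ) (u v : Fin k → ℂ) :
    Matrix (Fin k) (Fin k) ℂ :=
  Matrix.of fun i j => Matrix.vecMul (wRow k A u v) (A ^ (i : ℕ)) j

/-- Extend a `k × k` matrix by zero to an `ℕ`-indexed family of entries. -/
def extMat {α : Type*} [Zero α] (k : ℕ) (M : Matrix (Fin k) (Fin k) α) : ℕ → ℕ → α :=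
  fun i j => if h : i < k ∧ j < k then M ⟨i, h.1⟩ ⟨j, h.2⟩ else 0

section Helpers

open Polynomial

/-- A square matrix over `ℂ[X]` each of whose entries is zero or `X ^ (s ^ 2)`, where `s` is the
distance from the diagonal shifted by an antitone function of the row, is nonsingular as soon as
its diagonal has no zero. -/
lemma det_ne_zero_of_sq_exponents {m : ℕ} (A : Matrix (Fin m) (Fin m) ℂ[X]) (D : Fin m → ℤ)
    (hD : Antitone D)
    (hA : ∀ r c, A r c = 0 ∨ ∃ s : ℕ, (s : ℤ) = (c : ℕ) - (r : ℕ) + D r ∧ A r c = X ^ (s ^ 2))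
    (hd : ∀ r, A r r ≠ 0) : A.det ≠ 0 := by
  have hdiag : ∀ r, A r r = X ^ ((D r).toNat ^ 2) := by
    intro r
    obtain h | ⟨s, hs, h⟩ := hA r r
    · exact absurd h (hd r)
    · rw [h]; congr 2; omega
  have hDnn : ∀ r, 0 ≤ D r := by
    intro r
    obtain h | ⟨s, hs, h⟩ := hA r r
    · exact absurd h (hd r)
    · omega
  set N : ℕ := ∑ r, (D r).toNat ^ 2 with hN
  have key : ∀ σ : Equiv.Perm (Fin m), σ ≠ 1 → (∏ r, A r (σ r)).coeff N = 0 := by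
    intro σ hσ
    by_cases hz : ∃ r, A r (σ r) = 0
    · obtain ⟨r, hr⟩ := hz
      rw [Finset.prod_eq_zero (Finset.mem_univ r) hr, coeff_zero]
    · push Not at hz
      have hs : ∀ r, ∃ s : ℕ, (s : ℤ) = ((σ r : Fin m) : ℕ) - (r : ℕ) + D r ∧
          A r (σ r) = X ^ (s ^ 2) := fun r => (hA r (σ r)).resolve_left (hz r)
      choose s hs hAs using hs
      rw [Finset.prod_congr rfl fun r _ => hAs r, Finset.prod_pow_eq_pow_sum, coeff_X_pow,
        if_neg]
      intro hEq
      have hEq' : ∑ r, (D r) ^ 2 = ∑ r, (s r : ℤ) ^ 2 := by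
        have : (N : ℤ) = ((∑ r, s r ^ 2 : ℕ) : ℤ) := by exact_mod_cast hEq
        rw [hN] at this
        push_cast at this
        rw [← this]
        refine Finset.sum_congr rfl fun r _ => ?_
        rw [Int.toNat_of_nonneg (hDnn r)]
      have hanti : Antivary D (fun r : Fin m => ((r : ℕ) : ℤ)) := by
        intro i j hij
        exact hD (by simpa using (show ((i : ℕ) : ℤ) < ((j : ℕ) : ℤ) from hij).le)
      have hre := hanti.sum_smul_le_sum_smul_comp_perm (σ := σ)
      simp only [smul_eq_mul] at hre
      have hexp : ∑ r, (s r : ℤ) ^ 2 = ∑ r, (D r) ^ 2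
          + ∑ r, ((((σ r : Fin m) : ℕ) : ℤ) - (r : ℕ)) ^ 2
          + 2 * (∑ r, D r * (((σ r : Fin m) : ℕ) : ℤ) - ∑ r, D r * ((r : ℕ) : ℤ)) := by
        rw [← Finset.sum_sub_distrib, Finset.mul_sum, ← Finset.sum_add_distrib,
          ← Finset.sum_add_distrib]
        refine Finset.sum_congr rfl fun r _ => ?_
        rw [hs]; ring
      have hnn : ∀ r ∈ (Finset.univ : Finset (Fin m)),
          0 ≤ ((((σ r : Fin m) : ℕ) : ℤ) - (r : ℕ)) ^ 2 := fun r _ => sq_nonneg _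
      have h0 : ∑ r, ((((σ r : Fin m) : ℕ) : ℤ) - (r : ℕ)) ^ 2 = 0 :=
        le_antisymm (by linarith) (Finset.sum_nonneg hnn)
      apply hσ
      ext r
      have := (Finset.sum_eq_zero_iff_of_nonneg hnn).1 h0 r (Finset.mem_univ r)
      have := pow_eq_zero_iff (two_ne_zero) |>.1 this
      simp only [Equiv.Perm.coe_one, id_eq]
      omega
  have hcoeff : A.det.coeff N = 1 := by
    rw [← Matrix.det_transpose, Matrix.det_apply, finsetSum_coeff,
      Finset.sum_eq_single (1 : Equiv.Perm (Fin m))]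
    · simp only [Equiv.Perm.sign_one, one_smul, Matrix.transpose_apply, Equiv.Perm.coe_one, id_eq]
      rw [Finset.prod_congr rfl fun r _ => hdiag r, Finset.prod_pow_eq_pow_sum, coeff_X_pow,
        if_pos rfl]
    · intro σ _ hσ
      simp only [Matrix.transpose_apply, coeff_smul]
      rw [key σ hσ, smul_zero]
    · simp
  intro h
  rw [h, coeff_zero] at hcoeff
  exact zero_ne_one hcoeff

lemma eval_det_eq_det_map {R : Type*} [CommRing R] {m : ℕ} (A : Matrix (Fin m) (Fin m) R[X])
    (x : R) : A.det.eval x = (A.map (eval x)).det := by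
  rw [← coe_evalRingHom, RingHom.map_det]
  rfl

section Map

variable {α β : Type*} [CommRing α] [CommRing β]

lemma map_bandX (f : α →+* β) (n k : ℕ) (a : ℕ → ℕ → α) (i j : ℕ) :
    f (bandX n k a i j) = bandX n k (fun s l => f (a s l)) i j := by
  simp only [bandX, apply_ite f, map_zero]

lemma map_bandY (f : α →+* β) (n k : ℕ) (a : ℕ → ℕ → α) (i j : ℕ) :
    f (bandY n k a i j) = bandY n k (fun s l => f (a s l)) i j := by
  simp only [bandY, apply_ite f, map_zero]

/-- The core of the band pair built from `a`. -/
abbrev bandCore (n k : ℕ) (a : ℕ → ℕ → α) : ℕ → ℕ → α :=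
  stairCore n k (bandX n k a) (bandY n k a)

lemma map_bandCore (f : α →+* β) (n k : ℕ) (a : ℕ → ℕ → α) (r c : ℕ) :
    f (bandCore n k a r c) = bandCore n k (fun s l => f (a s l)) r c := by
  simp only [bandCore, stairCore, apply_ite f, map_zero, map_bandX, map_bandY]

lemma map_sminor_bandCore (f : α →+* β) (n k : ℕ) (a : ℕ → ℕ → α) (i M : ℕ) :
    f (sminor (bandCore n k a) i M) = sminor (bandCore n k (fun s l => f (a s l))) i M := by
  rw [sminor, sminor, RingHom.map_det]
  congr 1
  ext r c
  simp [map_bandCore f]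

end Map

/-- Each entry of the leading part of the band core is zero or one of the `a s i`, where
`i` is determined by the row and `s` by the row and the distance from the diagonal. -/
lemma bandCore_eq_zero_or {α : Type*} [CommRing α] {n k : ℕ} (hn : k < n) (a : ℕ → ℕ → α) {r : ℕ}
    (hr : r < (k - 1) * (n - 1)) (c : ℕ) :
    bandCore n k a r c = 0 ∨ ∃ s : ℕ, (s : ℤ) = c - r + (k - (r / (n - 1) : ℕ)) ∧
      bandCore n k a r c = a s (r % (n - 1) + 2) := by
  have hdm := Nat.div_add_mod r (n - 1)
  obtain ⟨n, rfl⟩ : ∃ n', n = n' + 1 := ⟨n - 1, by omega⟩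
  simp only [bandCore, stairCore, if_pos hr]
  simp only [Nat.add_sub_cancel] at *
  generalize r / n = q at *
  generalize r % n = ρ at *
  have hq : q * (n + 1) = n * q + q := by ring
  split_ifs with h1 h2
  · simp only [bandY]
    split_ifs with h3
    · exact Or.inr ⟨_, by omega, rfl⟩
    · exact Or.inl rfl
  · simp only [bandX]
    have hq' : (q - 1) * (n + 1) + (n + 1) = q * (n + 1) := by
      rw [← Nat.succ_mul, Nat.succ_eq_add_one, Nat.sub_add_cancel h2.1]
    split_ifs with h3
    · exact Or.inr ⟨_, by omega, rfl⟩
    · exact Or.inl rfl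
  · exact Or.inl rfl

lemma bandCore_diag {α : Type*} [CommRing α] {n k : ℕ} (hn : k < n) (a : ℕ → ℕ → α) {r : ℕ}
    (hr : r < (k - 1) * (n - 1)) :
    bandCore n k a r r = a (k - r / (n - 1)) (r % (n - 1) + 2) := by
  have hdm := Nat.div_add_mod r (n - 1)
  have hqk : r / (n - 1) < k - 1 := Nat.div_lt_of_lt_mul (by rwa [mul_comm])
  have hlt := Nat.mod_lt r (Nat.pos_of_ne_zero (fun h => by simp [h] at hr) : 0 < n - 1)
  obtain ⟨n, rfl⟩ : ∃ n', n = n' + 1 := ⟨n - 1, by omega⟩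
  simp only [bandCore, stairCore, if_pos hr]
  simp only [Nat.add_sub_cancel] at *
  generalize r / n = q at *
  generalize r % n = ρ at *
  have hq : q * (n + 1) = n * q + q := by ring
  have hq' : 1 ≤ q → (q - 1) * (n + 1) + (n + 1) = q * (n + 1) := fun h => by
    rw [← Nat.succ_mul, Nat.succ_eq_add_one, Nat.sub_add_cancel h]
  split_ifs with h1 h2
  · rw [bandY, if_pos (by omega)]
    congr 1
    omega
  · specialize hq' h2.1
    rw [bandX, if_pos (by omega)]
    congr 1
    omega
  · exfalso
    have h3 : 1 ≤ q := by omega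
    specialize hq' h3
    exact h2 (by omega)

/-- Band entries over `ℂ[X]`: `X ^ (s ^ 2)` at `(s, i)`, except that the first row of the band
has a single nonzero entry and the entries `(k + 1, i)` and `(k, 2)` vanish. -/
def sqEntries (k : ℕ) : ℕ → ℕ → ℂ[X] := fun s i =>
  if i = 1 then if s = k then 1 else 0
  else if s = k + 1 then 0 else if s = k ∧ i = 2 then 0 else X ^ (s ^ 2)

/-- The deformation of `sqEntries` in which the entry `(k, 2)` is a new variable. -/
def sqEntriesDef (k : ℕ) : ℕ → ℕ → ℂ[X][X] := fun s i =>
  if s = k ∧ i = 2 then X else C (sqEntries k s i)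

lemma eval_sqEntriesDef (k s i : ℕ) :
    (sqEntriesDef k s i).eval 0 = sqEntries k s i := by
  unfold sqEntriesDef sqEntries
  split_ifs <;> simp_all

/-- The trailing minors of the leading part of the band core of `sqEntries` that avoid the first
row do not vanish. -/
lemma sminor_sqEntries_ne_zero {n k : ℕ} (hk : 2 < k) (hn : k < n) {i : ℕ} (hi : 2 ≤ i) :
    sminor (bandCore n k (sqEntries k)) i ((k - 1) * (n - 1)) ≠ 0 := by
  refine det_ne_zero_of_sq_exponents _
    (fun r => k - (((i - 1 + (r : ℕ)) / (n - 1) : ℕ) : ℤ)) ?_ ?_ ?_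
  · intro r r' h
    have : (i - 1 + (r : ℕ)) / (n - 1) ≤ (i - 1 + (r' : ℕ)) / (n - 1) :=
      Nat.div_le_div_right (by simpa using h)
    simp only
    omega
  · intro r c
    have hr := r.isLt
    simp only [Matrix.of_apply]
    obtain h | ⟨s, hs, h⟩ := bandCore_eq_zero_or hn (sqEntries k)
      (show i - 1 + (r : ℕ) < (k - 1) * (n - 1) by omega) (i - 1 + c)
    · exact Or.inl h
    · rw [h, sqEntries, if_neg (by omega)]
      split_ifs
      · exact Or.inl rfl
      · exact Or.inl rfl
      · exact Or.inr ⟨s, by push_cast at hs ⊢; omega, rfl⟩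
  · intro r
    have hr := r.isLt
    have hlt : i - 1 + (r : ℕ) < (k - 1) * (n - 1) := by omega
    have hle := Nat.sub_le k ((i - 1 + (r : ℕ)) / (n - 1))
    simp only [Matrix.of_apply]
    rw [bandCore_diag hn _ hlt, sqEntries, if_neg (by omega), if_neg (by omega), if_neg]
    · exact pow_ne_zero _ X_ne_zero
    · rintro ⟨h1, h2⟩
      have h3 : (i - 1 + (r : ℕ)) / (n - 1) = 0 := by omega
      have h4 := Nat.div_add_mod (i - 1 + (r : ℕ)) (n - 1)
      rw [h3] at h4
      omega

lemma X_dvd_sminor_one {n k : ℕ} (hk : 2 < k) (hn : k < n) :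
    (X : ℂ[X][X]) ∣ sminor (bandCore n k (sqEntriesDef k)) 1 ((k - 1) * (n - 1)) := by
  have hM : 0 < (k - 1) * (n - 1) := Nat.mul_pos (by omega) (by omega)
  rw [X_dvd_iff, coeff_zero_eq_eval_zero, ← coe_evalRingHom, map_sminor_bandCore]
  simp only [coe_evalRingHom, eval_sqEntriesDef]
  refine Matrix.det_eq_zero_of_row_eq_zero ⟨0, by omega⟩ fun c => ?_
  simp only [Matrix.of_apply]
  have h0 : 0 < n := by omega
  simp only [stairCore, bandY, Nat.sub_self, zero_add, hM, if_true, Nat.zero_div, Nat.zero_mod,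
    zero_mul, Nat.zero_le, true_and, Nat.sub_zero]
  split_ifs with h1 h2 h3
  · have : (c : ℕ) = 0 ∨ (c : ℕ) = 1 := by omega
    rcases this with h | h <;> simp [h, sqEntries]
  · rfl
  · omega
  · rfl

/-- The coefficient of `X` in `det (Y + X • X')` for the band pair `(X', Y)` built from
`sqEntriesDef`. -/
lemma coeff_one_det_sqEntriesDef {n k : ℕ} (hk : 2 < k) (hn : k < n) :
    ∃ w : ℂ[X], w ≠ 0 ∧
      (Matrix.of fun i j : Fin n => (C (bandY n k (sqEntriesDef k) i j)
        + X * C (bandX n k (sqEntriesDef k) i j) : ℂ[X][X][X])).det.coeff 1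
        = X * C w := by
  obtain ⟨m, rfl⟩ : ∃ m, n = m + 2 := ⟨n - 2, by omega⟩
  refine ⟨(-1) ^ (m + 1) * (X ^ (k ^ 2)) ^ m, ?_, ?_⟩
  · exact mul_ne_zero (pow_ne_zero _ (by simp)) (pow_ne_zero _ (pow_ne_zero _ X_ne_zero))
  have hS : sqEntriesDef k (k + 1) = fun _ => 0 := by
    ext1 i
    simp [sqEntriesDef, sqEntries]
  have hY0 (j : ℕ) : bandY (m + 2) k (sqEntriesDef k) 0 j = 0 := by
    unfold bandY
    split_ifs with h
    · rw [show k + 1 + j - 0 = k + 1 by omega, hS]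
    · rfl
  have hX0 (j : ℕ) : bandX (m + 2) k (sqEntriesDef k) 0 j = if j = m + 1 then 1 else 0 := by
    unfold bandX
    split_ifs with h h' h'
    · rw [show j + k + 1 - (m + 2) - 0 = k by omega]
      simp [sqEntriesDef, sqEntries]
    · have : j + k + 1 - (m + 2) - 0 ≠ k := by omega
      generalize j + k + 1 - (m + 2) - 0 = s at this
      simp [sqEntriesDef, sqEntries, this]
    · omega
    · rfl
  have hYu (i j : ℕ) (hij : i < j) : bandY (m + 2) k (sqEntriesDef k) (i + 1) j = 0 := by
    unfold bandY
    split_ifs with h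
    · rw [show k + 1 + j - (i + 1) = k + 1 by omega, hS]
    · rfl
  have hYd (i : ℕ) (hi : i < m + 1) :
      bandY (m + 2) k (sqEntriesDef k) (i + 1) i = sqEntriesDef k k (i + 2) := by
    rw [bandY, if_pos (by omega), show k + 1 + i - (i + 1) = k by omega]
  set B : Matrix (Fin (m + 2)) (Fin (m + 2)) ℂ[X][X][X] :=
    Matrix.of fun i j => C (bandY (m + 2) k (sqEntriesDef k) i j)
      + X * C (bandX (m + 2) k (sqEntriesDef k) i j) with hB
  have hB0 (j : Fin (m + 2)) : B 0 j = if (j : ℕ) = m + 1 then X else 0 := by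
    rw [hB, Matrix.of_apply, Fin.val_zero, hY0, hX0]
    split_ifs <;> simp
  have hdet : (B.submatrix Fin.succ (Fin.last (m + 1)).succAbove).det.eval 0
      = X * C ((X ^ (k ^ 2)) ^ m) := by
    rw [eval_det_eq_det_map, Matrix.det_of_isLowerTriangular]
    · have hf (x : Fin m) : sqEntriesDef k k ((x : ℕ) + 1 + 2) = C (X ^ (k ^ 2)) := by
        simp [sqEntriesDef, sqEntries]
      have h2 : sqEntriesDef k k 2 = X := by simp [sqEntriesDef]
      simp [Fin.prod_univ_succ, hB, hYd, hf, h2]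
    · intro i j hij
      have hij' : (i : ℕ) < (j : ℕ) := by simpa using hij
      simp [hB, hYu _ _ hij']
  rw [Matrix.det_succ_row_zero, Finset.sum_eq_single (Fin.last (m + 1))]
  · rw [hB0, Fin.val_last, if_pos rfl]
    generalize B.submatrix Fin.succ (Fin.last (m + 1)).succAbove = A at hdet ⊢
    rw [show (-1) ^ (m + 1) * X * A.det = (-1) ^ (m + 1) * A.det * X by ring, coeff_mul_X,
      coeff_zero_eq_eval_zero, eval_mul, hdet]
    simp only [eval_pow, eval_neg, eval_one, map_mul, map_pow, map_neg, map_one]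
    ring
  · intro j _ hj
    rw [hB0, if_neg (show (j : ℕ) ≠ m + 1 from fun h => hj (Fin.ext h)), mul_zero, zero_mul]
  · simp

/-- If `det (λ Y + μ X)` expands as `λ ^ (n - k) * ∑ c i μ ^ i λ ^ (k - i)`, then `c 1` is the
coefficient of `μ` in `det (Y + μ X)`, also after a base change `f`. -/
lemma map_one_eq_coeff_det {α β : Type*} [CommRing α] [CommRing β] (f : α →+* β) {n k : ℕ}
    (hk : 1 ≤ k) {Xf Yf : ℕ → ℕ → α} {c : ℕ → α}
    (hc : detLM n Xf Yf = (MvPolynomial.X 0 : MvPolynomial (Fin 2) α) ^ (n - k)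
      * ∑ i ∈ Finset.range (k + 1), MvPolynomial.C (c i)
          * (MvPolynomial.X 1 : MvPolynomial (Fin 2) α) ^ i
          * (MvPolynomial.X 0 : MvPolynomial (Fin 2) α) ^ (k - i)) :
    f (c 1)
      = (Matrix.of fun i j : Fin n => (C (f (Yf i j)) + X * C (f (Xf i j)) : β[X])).det.coeff 1 := by
  have h := congrArg (MvPolynomial.eval₂Hom ((C : β →+* β[X]).comp f) ![1, X]) hc
  rw [detLM, RingHom.map_det] at h
  have h' : (MvPolynomial.eval₂Hom ((C : β →+* β[X]).comp f) ![1, X]).mapMatrix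
      ((MvPolynomial.X 0 : MvPolynomial (Fin 2) α) • (toSq n Yf).map (fun p => MvPolynomial.C p)
        + (MvPolynomial.X 1 : MvPolynomial (Fin 2) α) • (toSq n Xf).map
          (fun p => MvPolynomial.C p))
      = Matrix.of fun i j : Fin n => (C (f (Yf i j)) + X * C (f (Xf i j)) : β[X]) := by
    ext1 i j
    simp [toSq]
  rw [h'] at h
  rw [h]
  simp [coeff_C_mul, coeff_X_pow, show k ≠ 0 by omega]

/-- Specialization of the generic band entries to `sqEntriesDef`. -/
def specSq (k : ℕ) : Rband →+* ℂ[X][X] :=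
  MvPolynomial.eval₂Hom (C.comp C) fun p => sqEntriesDef k p.1 p.2

lemma specSq_genA (k s i : ℕ) : specSq k (genA s i) = sqEntriesDef k s i := by
  simp [specSq, genA]

lemma not_sq_dvd_specSq {n k : ℕ} (hk : 2 < k) (hn : k < n) {w : ℂ[X]} (hw : w ≠ 0) (e : ℕ) :
    ¬ (X : ℂ[X][X]) ^ 2 ∣ (-1) ^ e * (X * C w)
      * sminor (bandCore n k (sqEntriesDef k)) (n + 1) ((k - 1) * (n - 1))
      * sminor (bandCore n k (sqEntriesDef k)) 2 ((k - 1) * (n - 1)) ^ (k - 1) := by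
  have hX {i : ℕ} (hi : 2 ≤ i) :
      ¬ (X : ℂ[X][X]) ∣ sminor (bandCore n k (sqEntriesDef k)) i ((k - 1) * (n - 1)) := by
    rw [X_dvd_iff, coeff_zero_eq_eval_zero, ← coe_evalRingHom, map_sminor_bandCore]
    simp only [coe_evalRingHom, eval_sqEntriesDef]
    exact sminor_sqEntries_ne_zero hk hn hi
  generalize sminor (bandCore n k (sqEntriesDef k)) = φ at hX
  intro h
  rw [show ∀ u v : ℂ[X][X], (-1) ^ e * (X * C w) * u * v = X * ((-1) ^ e * C w * u * v)
    from fun u v => by ring, sq] at h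
  have h := (mul_dvd_mul_iff_left (X_ne_zero (R := ℂ[X]))).1 h
  have hp : Prime (X : ℂ[X][X]) := prime_X
  rcases hp.dvd_or_dvd h with h | h
  · rcases hp.dvd_or_dvd h with h | h
    · rcases hp.dvd_or_dvd h with h | h
      · exact hp.not_dvd_one ((dvd_neg).1 (hp.dvd_of_dvd_pow h))
      · exact hw (by simpa using X_dvd_iff.1 h)
    · exact hX (by omega) h
  · exact hX le_rfl (hp.dvd_of_dvd_pow h)

end Helpers

/-- for `k > 2`, `φ̃_1²` does not divide the generalized exchange
polynomial in the generic band situation. -/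
theorem statement18 (n k : ℕ) (hk : 2 < k) (hn : k < n) (c : ℕ → Rband)
    (hc : detLM n (bandX n k genA) (bandY n k genA)
        = (MvPolynomial.X 0 : MvPolynomial (Fin 2) Rband) ^ (n - k)
          * ∑ i ∈ Finset.range (k + 1), MvPolynomial.C (c i)
              * (MvPolynomial.X 1 : MvPolynomial (Fin 2) Rband) ^ i
              * (MvPolynomial.X 0 : MvPolynomial (Fin 2) Rband) ^ (k - i)) :
    ¬ ((sminor (stairCore n k (bandX n k genA) (bandY n k genA)) 1 ((k - 1) * (n - 1))) ^ 2 ∣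
        genA (k + 1) 1
            * (sminor (stairCore n k (bandX n k genA) (bandY n k genA)) 2
                ((k - 1) * (n - 1))) ^ k
          + ∑ i ∈ Finset.Icc 1 k,
              ((-1 : Rband) ^ (i * (n - 1)) * c i)
                * (∏ j ∈ Finset.Icc 2 n, genA (k + 1) j) ^ (i - 1)
                * (sminor (stairCore n k (bandX n k genA) (bandY n k genA)) (n + 1)
                    ((k - 1) * (n - 1))) ^ i
                * (sminor (stairCore n k (bandX n k genA) (bandY n k genA)) 2
                    ((k - 1) * (n - 1))) ^ (k - i)) := by
  intro h
  obtain ⟨w, hw, hcoeff⟩ := coeff_one_det_sqEntriesDef hk hn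
  have hc1 := map_one_eq_coeff_det (specSq k) (by omega) hc
  simp only [map_bandX (specSq k), map_bandY (specSq k), specSq_genA] at hc1
  rw [hcoeff] at hc1
  have hminor (i : ℕ) : specSq k (sminor (stairCore n k (bandX n k genA) (bandY n k genA)) i
      ((k - 1) * (n - 1))) = sminor (bandCore n k (sqEntriesDef k)) i ((k - 1) * (n - 1)) := by
    rw [map_sminor_bandCore]
    simp only [specSq_genA]
  have hzero (j : ℕ) : sqEntriesDef k (k + 1) j = 0 := by simp [sqEntriesDef, sqEntries]
  have hprod : ∏ _j ∈ Finset.Icc 2 n, (0 : Polynomial (Polynomial ℂ)) = 0 :=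
    Finset.prod_eq_zero (Finset.mem_Icc.2 ⟨le_rfl, by omega⟩ : 2 ∈ Finset.Icc 2 n) rfl
  have h2 := map_dvd (specSq k) h
  simp only [map_add, map_mul, map_pow, map_sum, map_prod, map_neg, map_one, hminor, specSq_genA,
    hzero, hprod, zero_mul, zero_add] at h2
  rw [Finset.sum_eq_single 1, hc1, Nat.sub_self, pow_zero, mul_one, pow_one] at h2
  · exact not_sq_dvd_specSq hk hn hw _ ((pow_dvd_pow_of_dvd (X_dvd_sminor_one hk hn) 2).trans h2)
  · intro i hi h1
    rw [Finset.mem_Icc] at hi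
    rw [zero_pow (by omega), mul_zero, zero_mul, zero_mul]
  · intro h1
    exact absurd (Finset.mem_Icc.2 ⟨le_rfl, by omega⟩) h1

end
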